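/- Let σ ≥ 0 and Δt > 0. Let u⁰ ∈ ℝ^{n_x×N} and B⁰, Φ¹, B¹ ∈ ℝ^{n_x} satisfy Φ¹ = u⁰ e₁ − Δt·D^x u⁰ A e₁ + Δt·D^xx u⁰ |A| e₁ + σΔt·(B¹ − Φ¹) and B¹ = B⁰ + σΔt·(Φ¹ − B¹), where e₁ ∈ ℝ^{N} is the first standard basis vector. Then total mass is conserved: Σ_{j=1}^{n_x} ( Φ¹_j + B¹_j ) = Σ_{j=1}^{n_x} ( (u⁰ e₁)_j + B⁰_j ). -/

import Mathlib

open Matrix Finset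

/-- Periodic first-order central difference stencil matrix `D^x`. -/
noncomputable def Dx (nx : ℕ) [NeZero nx] (dx : ℝ) : Matrix (Fin nx) (Fin nx) ℝ :=
  Matrix.of fun p q =>
    if q = p + 1 then 1 / (2 * dx) else if q = p - 1 then -(1 / (2 * dx)) else 0

/-- Periodic second-order stabilization stencil matrix `D^xx`. -/
noncomputable def Dxx (nx : ℕ) [NeZero nx] (dx : ℝ) : Matrix (Fin nx) (Fin nx) ℝ :=
  Matrix.of fun p q =>
    if q = p then -(1 / dx) else if q = p + 1 ∨ q = p - 1 then 1 / (2 * dx) else 0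

/-- The first standard basis vector `e₁ ∈ ℝ^N` (zeroth angular moment). -/
def e1 (N : ℕ) [NeZero N] : Fin N → ℝ := fun m => if m = 0 then 1 else 0

theorem aux_one_ne (nx : ℕ) [NeZero nx] (hnx : 3 ≤ nx) : (1 : Fin nx) ≠ 0 := by
  obtain ⟨k, rfl⟩ : ∃ k, nx = k + 3 := ⟨nx - 3, by omega⟩
  intro h
  have := congrArg Fin.val h
  simp at this

theorem aux_two_ne (nx : ℕ) [NeZero nx] (hnx : 3 ≤ nx) : (1 + 1 : Fin nx) ≠ 0 := by
  obtain ⟨k, rfl⟩ : ∃ k, nx = k + 3 := ⟨nx - 3, by omega⟩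
  intro h
  have := congrArg Fin.val h
  rw [Fin.val_add] at this
  simp at this
  rw [Nat.mod_eq_of_lt (by omega)] at this
  omega

theorem aux_Dx (nx : ℕ) [NeZero nx] (hnx : 3 ≤ nx) (dx : ℝ) (q : Fin nx) :
    ∑ p, Dx nx dx p q = 0 := by
  have h2 := aux_two_ne nx hnx
  have key : ∀ p, Dx nx dx p q =
      (if p = q - 1 then 1 / (2 * dx) else 0) - (if p = q + 1 then 1 / (2 * dx) else 0) := by
    intro p
    have e1 : q = p + 1 ↔ p = q - 1 := by rw [eq_sub_iff_add_eq, eq_comm]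
    have e2 : q = p - 1 ↔ p = q + 1 := by rw [eq_sub_iff_add_eq, eq_comm]
    simp only [Dx, Matrix.of_apply, e1, e2]
    by_cases h : p = q - 1
    · have : p ≠ q + 1 := by
        rintro h'
        apply h2
        rw [h, sub_eq_iff_eq_add, add_assoc] at h'
        simpa using h'
      rw [if_pos h, if_pos h, if_neg this, sub_zero]
    · rw [if_neg h, if_neg h]
      split_ifs <;> simp
  simp only [key, Finset.sum_sub_distrib, Finset.sum_ite_eq', Finset.mem_univ, if_true, sub_self,
    Finset.sum_ite_eq]

theorem aux_Dxx (nx : ℕ) [NeZero nx] (hnx : 3 ≤ nx) (dx : ℝ) (q : Fin nx) :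
    ∑ p, Dxx nx dx p q = 0 := by
  have h1 := aux_one_ne nx hnx
  have h2 := aux_two_ne nx hnx
  have key : ∀ p, Dxx nx dx p q =
      (if p = q then -(1 / dx) else 0) + (if p = q - 1 then 1 / (2 * dx) else 0)
        + (if p = q + 1 then 1 / (2 * dx) else 0) := by
    intro p
    have e1 : q = p + 1 ↔ p = q - 1 := by rw [eq_sub_iff_add_eq, eq_comm]
    have e2 : q = p - 1 ↔ p = q + 1 := by rw [eq_sub_iff_add_eq, eq_comm]
    have e0 : q = p ↔ p = q := eq_comm
    simp only [Dxx, Matrix.of_apply, e0, e1, e2]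
    by_cases h0 : p = q
    · subst h0
      have a : p ≠ p - 1 := by
        intro h; apply h1; rw [eq_sub_iff_add_eq] at h; simpa using h
      have b : p ≠ p + 1 := by
        intro h; apply h1; simpa using h.symm
      rw [if_neg a, if_neg b]
      simp
    · by_cases h : p = q - 1
      · have : p ≠ q + 1 := by
          rintro h'
          apply h2
          rw [h, sub_eq_iff_eq_add, add_assoc] at h'
          simpa using h'
        rw [if_neg h0, if_neg h0, if_pos (Or.inl h), if_pos h, if_neg this]
        simp
      · by_cases h' : p = q + 1
        · rw [if_neg h0, if_neg h0, if_pos (Or.inr h'), if_neg h, if_pos h']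
          simp
        · rw [if_neg h0, if_neg h0, if_neg (not_or.mpr ⟨h, h'⟩), if_neg h, if_neg h']
          simp
  simp only [key, Finset.sum_add_distrib, Finset.sum_ite_eq', Finset.mem_univ, if_true]
  rw [one_div, one_div, mul_inv]
  ring

theorem aux_sum {nx N : ℕ} (D : Matrix (Fin nx) (Fin nx) ℝ) (hD : ∀ q, ∑ p, D p q = 0)
    (u : Matrix (Fin nx) (Fin N) ℝ) (A : Matrix (Fin N) (Fin N) ℝ) (v : Fin N → ℝ) :
    ∑ j, (D * u * A).mulVec v j = 0 := by
  rw [Matrix.mul_assoc, ← Matrix.mulVec_mulVec]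
  simp only [Matrix.mulVec, dotProduct]
  rw [Finset.sum_comm]
  simp only [← Finset.sum_mul, hD, zero_mul, Finset.sum_const_zero]

/-- Theorem 4 of the paper (local/total mass conservation): if the scalar flux `Φ¹` and
internal energy `B¹` satisfy the coupled update
`Φ¹ = u⁰e₁ − Δt D^x u⁰ A e₁ + Δt D^xx u⁰ |A| e₁ + σΔt (B¹ − Φ¹)`,
`B¹ = B⁰ + σΔt (Φ¹ − B¹)`, then `Σ_j (Φ¹_j + B¹_j) = Σ_j ((u⁰e₁)_j + B⁰_j)`. -/
theorem mass_conservation (nx N : ℕ) [NeZero nx] [NeZero N] (hnx : 3 ≤ nx)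
    (dx dt σ : ℝ) (hdx : 0 < dx) (hdt : 0 < dt) (hσ : 0 ≤ σ)
    (Q : Matrix (Fin N) (Fin N) ℝ) (hQ : Qᵀ * Q = 1) (hQ' : Q * Qᵀ = 1)
    (σs : Fin N → ℝ)
    (u0 : Matrix (Fin nx) (Fin N) ℝ) (B0 Phi1 B1 : Fin nx → ℝ)
    (hPhi1 : Phi1 = u0.mulVec (e1 N)
        - dt • (Dx nx dx * u0 * (Q * Matrix.diagonal σs * Qᵀ)).mulVec (e1 N)
        + dt • (Dxx nx dx * u0 * (Q * Matrix.diagonal (fun i => |σs i|) * Qᵀ)).mulVec (e1 N)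
        + (σ * dt) • (B1 - Phi1))
    (hB1 : B1 = B0 + (σ * dt) • (Phi1 - B1)) :
    ∑ j, (Phi1 j + B1 j) = ∑ j, (u0.mulVec (e1 N) j + B0 j) := by
  have hx := aux_sum (Dx nx dx) (aux_Dx nx hnx dx) u0 (Q * Matrix.diagonal σs * Qᵀ) (e1 N)
  have hxx := aux_sum (Dxx nx dx) (aux_Dxx nx hnx dx) u0
    (Q * Matrix.diagonal (fun i => |σs i|) * Qᵀ) (e1 N)
  have key : ∀ j, Phi1 j + B1 j = (u0.mulVec (e1 N) j + B0 j)
      - dt * (Dx nx dx * u0 * (Q * Matrix.diagonal σs * Qᵀ)).mulVec (e1 N) j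
      + dt * (Dxx nx dx * u0 * (Q * Matrix.diagonal (fun i => |σs i|) * Qᵀ)).mulVec (e1 N) j := by
    intro j
    have a := congrFun hPhi1 j
    have b := congrFun hB1 j
    simp only [Pi.add_apply, Pi.sub_apply, Pi.smul_apply, smul_eq_mul] at a b
    linarith
  rw [Finset.sum_congr rfl (fun j _ => key j), Finset.sum_add_distrib, Finset.sum_sub_distrib,
    ← Finset.mul_sum, ← Finset.mul_sum, hx, hxx]
  simp
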